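/- Let I, J ⊆ {1,…,n} be disjoint with I ∪ J nonempty, and let α_k ≥ 0 for k ∈ I ∪ J with min_{k∈I∪J} α_k = 0. Define v ∈ ℝⁿ by v_i = −α_i for i ∈ I, v_j = α_j for j ∈ J, v_k = 0 otherwise, and w ∈ ℝⁿ by w_i = 1 for i ∈ I, w_j = −1 for j ∈ J, w_k = 0 otherwise; for t > 0 let ψ(t) = exp(tw + v) = (e^{t w_1 + v_1},…,e^{t w_n + v_n}) ∈ (0,∞)ⁿ. Then d_T(ψ(t), u) = t for all t ≥ max_{k∈I∪J} α_k, and for every x ∈ (0,∞)ⁿ, lim_{t→∞} ( d_T(x, ψ(t)) − t ) = max( max_{i∈I}(−α_i − log x_i), max_{j∈J}(−α_j + log x_j) ), where a maximum over an empty index set is omitted. -/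

import Mathlib

open Filter Topology

/-- The internal function `h_y(z) = d(z,y) - d(b,y)` of a point `y`, for the
distance `d` with basepoint `b`. -/
noncomputable def intFn {M : Type*} (d : M → M → ℝ) (b y : M) : M → ℝ :=
  fun z => d z y - d b y

/-- The horofunction compactification of `(M,d)` with basepoint `b`: the closure of the
set of internal functions in the space of all real functions on `M` with the topology of
pointwise convergence. -/
def horoCpt {M : Type*} (d : M → M → ℝ) (b : M) : Set (M → ℝ) :=
  closure (Set.range (intFn d b))

/-- The detour cost `H(h,h')`. -/
noncomputable def detourCost {M : Type*} (d : M → M → ℝ) (b : M) (h h' : M → ℝ) : EReal :=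
  ⨆ W ∈ 𝓝[horoCpt d b] h, ⨅ x ∈ {x : M | intFn d b x ∈ W}, ((d b x + h' x : ℝ) : EReal)

/-- The detour distance `δ(h,h') = H(h,h') + H(h',h)`. -/
noncomputable def detourDist {M : Type*} (d : M → M → ℝ) (b : M) (h h' : M → ℝ) : EReal :=
  detourCost d b h h' + detourCost d b h' h

/-- The open positive orthant `(0,∞)ⁿ`. -/
def Pos (n : ℕ) : Type := {x : Fin n → ℝ // ∀ i, 0 < x i}

/-- The Thompson distance on the open positive orthant. -/
noncomputable def dT (n : ℕ) (x y : Pos n) : ℝ :=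
  ⨆ i, |Real.log (x.1 i) - Real.log (y.1 i)|

/-- The basepoint `u = (1,…,1)` of the positive orthant. -/
def uPos (n : ℕ) : Pos n := ⟨fun _ => 1, fun _ => one_pos⟩

/-- The componentwise exponential map `ℝⁿ → (0,∞)ⁿ`. -/
noncomputable def expPos (n : ℕ) (v : Fin n → ℝ) : Pos n :=
  ⟨fun i => Real.exp (v i), fun i => Real.exp_pos _⟩

/-- The Thompson distance is the largest coordinatewise log-distance. -/
theorem dT_eq_of_le_of_eq {n : ℕ} {x y : Pos n} {c : ℝ}
    (hle : ∀ i, |Real.log (x.1 i) - Real.log (y.1 i)| ≤ c)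
    (heq : ∃ i, |Real.log (x.1 i) - Real.log (y.1 i)| = c) : dT n x y = c := by
  obtain ⟨i, hi⟩ := heq
  have : Nonempty (Fin n) := ⟨i⟩
  refine le_antisymm (ciSup_le hle) ?_
  rw [← hi]
  exact le_ciSup (f := fun i => |Real.log (x.1 i) - Real.log (y.1 i)|)
    ⟨c, by rintro _ ⟨j, rfl⟩; exact hle j⟩ i

theorem stmt19 (n : ℕ) (hn : 1 ≤ n) (I J : Finset (Fin n)) (hd : Disjoint I J)
    (hne : (I ∪ J).Nonempty) (α : Fin n → ℝ) (hα : ∀ k ∈ I ∪ J, 0 ≤ α k)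
    (hmin : (I ∪ J).inf' hne α = 0)
    (v w : Fin n → ℝ)
    (hv : v = fun k => if k ∈ I then -α k else if k ∈ J then α k else 0)
    (hw : w = fun k => if k ∈ I then 1 else if k ∈ J then -1 else 0) :
    (∀ t : ℝ, (I ∪ J).sup' hne α ≤ t →
      dT n (expPos n fun k => t * w k + v k) (uPos n) = t) ∧
    (∀ x : Pos n,
      Tendsto (fun t : ℝ => dT n x (expPos n fun k => t * w k + v k) - t) atTop
        (𝓝 ((I ∪ J).sup' hne fun k =>
          if k ∈ I then -α k - Real.log (x.1 k) else -α k + Real.log (x.1 k)))) := by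
  subst hv hw
  constructor
  · intro t ht
    have hαt : ∀ k ∈ I ∪ J, α k ≤ t := fun k hk => (Finset.le_sup' α hk).trans ht
    obtain ⟨m, hm, hm0⟩ := Finset.exists_mem_eq_inf' hne α
    rw [hmin] at hm0
    have ht0 : 0 ≤ t := hm0.trans_le (hαt m hm)
    apply dT_eq_of_le_of_eq
    · intro k
      simp only [expPos, uPos, Real.log_exp, Real.log_one]
      by_cases hI : k ∈ I
      · have h1 := hα k (Finset.mem_union_left J hI)
        have h2 := hαt k (Finset.mem_union_left J hI)
        simp only [hI, if_true]
        rw [abs_le]; constructor <;> linarith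
      · by_cases hJ : k ∈ J
        · have h1 := hα k (Finset.mem_union_right I hJ)
          have h2 := hαt k (Finset.mem_union_right I hJ)
          simp only [hI, hJ, if_true, if_false]
          rw [abs_le]; constructor <;> linarith
        · simpa [hI, hJ] using ht0
    · refine ⟨m, ?_⟩
      simp only [expPos, uPos, Real.log_exp, Real.log_one, ← hm0]
      by_cases hI : m ∈ I
      · simp [hI, abs_of_nonneg ht0]
      · have hJ : m ∈ J := (Finset.mem_union.mp hm).resolve_left hI
        simp [hI, hJ, abs_of_nonneg ht0]
  · intro x
    set f : Fin n → ℝ := fun k =>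
      if k ∈ I then -α k - Real.log (x.1 k) else -α k + Real.log (x.1 k) with hf
    set M := (I ∪ J).sup' hne f with hM
    have hev : ∀ᶠ t : ℝ in atTop, ∀ k,
        |Real.log (x.1 k)| + |α k| ≤ t ∧ |Real.log (x.1 k)| - M ≤ t :=
      eventually_all.mpr fun k => (eventually_ge_atTop _).and (eventually_ge_atTop _)
    refine tendsto_const_nhds.congr' ?_
    filter_upwards [hev] with t ht
    have hcoord : ∀ k ∈ I ∪ J, |Real.log (x.1 k) -
        (t * (if k ∈ I then 1 else if k ∈ J then -1 else 0) +
          (if k ∈ I then -α k else if k ∈ J then α k else 0))| = t + f k := by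
      intro k hk
      have h1 := (ht k).1
      have h2 := abs_le.mp (le_refl |Real.log (x.1 k)|)
      have h3 := abs_le.mp (le_refl |α k|)
      by_cases hI : k ∈ I
      · simp only [hf, hI, if_true]
        rw [abs_of_nonpos (by linarith)]; ring
      · have hJ : k ∈ J := (Finset.mem_union.mp hk).resolve_left hI
        simp only [hf, hI, hJ, if_true, if_false]
        rw [abs_of_nonneg (by linarith)]; ring
    rw [eq_sub_iff_add_eq, add_comm, eq_comm]
    apply dT_eq_of_le_of_eq
    · intro k
      simp only [expPos, Real.log_exp]
      by_cases hk : k ∈ I ∪ J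
      · rw [hcoord k hk]
        exact add_le_add_right (Finset.le_sup' f hk) t
      · have h := (ht k).2
        rw [Finset.mem_union, not_or] at hk
        simp only [hk.1, hk.2, if_false, mul_zero, add_zero, sub_zero]
        linarith
    · obtain ⟨m, hm, hmM⟩ := Finset.exists_mem_eq_sup' hne f
      refine ⟨m, ?_⟩
      simp only [expPos, Real.log_exp]
      rw [hcoord m hm, hM, hmM]
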